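/- arXiv:2202.07914 — 3 statements merged into one kernel-verified Lean document; each statement's English description precedes it below -/
import Mathlib

section
/- Suppose κ is greatly weakly Mahlo and F is a filter witnessing the greatly weak Mahloness of κ. Then for every ordinal α < κ, the set {ξ < κ : ξ is α-weakly Mahlo} belongs to F. -/
/-- `C ⊆ δ` is club in `δ`: unbounded in `δ` and closed under suprema of
nonempty subsets whose supremum is `< δ`. -/
def IsClubIn (C : Set Ordinal) (δ : Ordinal) : Prop :=
  C ⊆ Set.Iio δ ∧ (∀ α < δ, ∃ β ∈ C, α ≤ β) ∧
    ∀ B : Set Ordinal, B ⊆ C → B.Nonempty → sSup B < δ → sSup B ∈ C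

/-- `S` is stationary in `δ`: it meets every club subset of `δ`. -/
def IsStationaryIn (S : Set Ordinal) (δ : Ordinal) : Prop :=
  ∀ C : Set Ordinal, IsClubIn C δ → (S ∩ C).Nonempty

/-- The ordinal `μ` is an infinite regular cardinal. -/
def IsInfRegular (μ : Ordinal) : Prop :=
  Ordinal.omega0 ≤ μ ∧ μ.cof.ord = μ

/-- The ordinal `μ` is an uncountable regular cardinal. -/
def IsUncRegular (μ : Ordinal) : Prop :=
  Ordinal.omega0 < μ ∧ μ.cof.ord = μ

/-- `κ` is weakly Mahlo: uncountable regular and the set of uncountable regular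
cardinals below `κ` is stationary in `κ`. -/
def IsWeaklyMahlo (κ : Ordinal) : Prop :=
  IsUncRegular κ ∧ IsStationaryIn {μ | μ < κ ∧ IsUncRegular μ} κ

/-- `κ` is `α`-weakly Mahlo, by recursion on `α`: `κ` is `0`-weakly Mahlo iff it is
weakly Mahlo; for `α ≠ 0`, `κ` is `α`-weakly Mahlo iff for every `β < α` the set of
`β`-weakly Mahlo cardinals below `κ` is stationary in `κ`. -/
def IsAlphaWeaklyMahlo (κ : Ordinal) (α : Ordinal) : Prop :=
  (α = 0 ∧ IsWeaklyMahlo κ) ∨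
    (α ≠ 0 ∧ ∀ β : Ordinal, β < α →
      IsStationaryIn {μ | μ < κ ∧ IsAlphaWeaklyMahlo μ β} κ)
termination_by α

/-- `Reg(κ)`: the set of infinite regular cardinals below `κ`. -/
def RegSet (κ : Ordinal) : Set Ordinal := {μ | μ < κ ∧ IsInfRegular μ}

/-- The Mahlo operation. -/
def Ml (S : Set Ordinal) : Set Ordinal :=
  {α | α ∈ S ∧ Cardinal.aleph0 < α.cof ∧ IsStationaryIn (S ∩ Set.Iio α) α}

/-- Iterates of the Mahlo operation. -/
noncomputable def MlIter (S : Set Ordinal) (α : Ordinal) : Set Ordinal :=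
  Ordinal.limitRecOn α S (fun _ ih => Ml ih)
    (fun γ _ ih => ⋂ (β : Ordinal), ⋂ (h : β < γ), ih β h)

/-- Diagonal intersection of a `κ`-indexed family of subsets of `κ`. -/
def diagInter (κ : Ordinal) (S : Ordinal → Set Ordinal) : Set Ordinal :=
  {β | β < κ ∧ ∀ α < β, β ∈ S α}

/-- A (proper) filter on the ordinal `κ`, i.e. on the set of ordinals `< κ`. -/
structure OrdFilter (κ : Ordinal) where
  sets : Set (Set Ordinal)
  mem_subset : ∀ S ∈ sets, S ⊆ Set.Iio κ
  univ_mem : Set.Iio κ ∈ sets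
  superset_mem : ∀ S ∈ sets, ∀ T : Set Ordinal, S ⊆ T → T ⊆ Set.Iio κ → T ∈ sets
  inter_mem : ∀ S ∈ sets, ∀ T ∈ sets, S ∩ T ∈ sets
  proper : (∅ : Set Ordinal) ∉ sets

/-- `F` is uniform: every end-segment `κ ∖ α` belongs to `F`. -/
def OrdFilter.Uniform {κ : Ordinal} (F : OrdFilter κ) : Prop :=
  ∀ α < κ, (Set.Iio κ \ Set.Iio α) ∈ F.sets

/-- `F` is non-principal: `κ ∖ {α}` belongs to `F` for every `α < κ`. -/
def OrdFilter.NonPrincipal {κ : Ordinal} (F : OrdFilter κ) : Prop :=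
  ∀ α < κ, (Set.Iio κ \ {α}) ∈ F.sets

/-- `F` is `< κ`-complete: closed under intersections of fewer than `κ` of its members. -/
def OrdFilter.Complete {κ : Ordinal} (F : OrdFilter κ) : Prop :=
  ∀ δ < κ, ∀ S : Ordinal → Set Ordinal, (∀ ξ < δ, S ξ ∈ F.sets) →
    (Set.Iio κ ∩ ⋂ (ξ : Ordinal), ⋂ (_ : ξ < δ), S ξ) ∈ F.sets

/-- `F` is normal: closed under diagonal intersections of `κ`-sequences of its members. -/
def OrdFilter.Normal {κ : Ordinal} (F : OrdFilter κ) : Prop :=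
  ∀ S : Ordinal → Set Ordinal, (∀ α < κ, S α ∈ F.sets) → diagInter κ S ∈ F.sets

/-- `κ` is weakly inaccessible: an uncountable regular limit cardinal. -/
def IsWeaklyInaccessible (κ : Ordinal) : Prop :=
  IsUncRegular κ ∧ ∀ c : Cardinal, c < κ.card → Order.succ c < κ.card

/-- `F` witnesses the greatly weak Mahloness of `κ`: `F` is a proper uniform
`< κ`-complete normal filter on `κ` containing `Reg(κ)` and closed under the
Mahlo operation. -/
def WitnessesGreatlyWeaklyMahlo (κ : Ordinal) (F : OrdFilter κ) : Prop :=
  F.Uniform ∧ F.Complete ∧ F.Normal ∧ RegSet κ ∈ F.sets ∧ ∀ S ∈ F.sets, Ml S ∈ F.sets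

/-- `κ` is greatly weakly Mahlo. -/
def IsGreatlyWeaklyMahlo (κ : Ordinal) : Prop :=
  IsWeaklyInaccessible κ ∧ ∃ F : OrdFilter κ, WitnessesGreatlyWeaklyMahlo κ F

theorem IsStationaryIn.mono {S T : Set Ordinal} {δ : Ordinal} (hS : IsStationaryIn S δ)
    (h : S ⊆ T) : IsStationaryIn T δ :=
  fun C hC => (hS C hC).mono (Set.inter_subset_inter_left C h)

theorem isUncRegular_of_mem_Ml_regSet {κ μ : Ordinal} (h : μ ∈ Ml (RegSet κ)) :
    IsUncRegular μ := by
  obtain ⟨⟨-, -, hreg⟩, hcof, -⟩ := h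
  refine ⟨?_, hreg⟩
  rw [← hreg, ← Cardinal.ord_aleph0]
  exact Cardinal.ord_lt_ord.2 hcof

theorem isWeaklyMahlo_of_mem_Ml_Ml_regSet {κ ξ : Ordinal} (h : ξ ∈ Ml (Ml (RegSet κ))) :
    IsWeaklyMahlo ξ :=
  ⟨isUncRegular_of_mem_Ml_regSet h.1,
    h.2.2.mono fun _ hμ => ⟨hμ.2, isUncRegular_of_mem_Ml_regSet hμ.1⟩⟩

/-- If `F` witnesses the greatly weak Mahloness of `κ`, then for every `α < κ` the set of
`α`-weakly Mahlo cardinals below `κ` belongs to `F`. -/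
theorem statement4 (κ : Ordinal) (hκ : IsWeaklyInaccessible κ) (F : OrdFilter κ)
    (hF : WitnessesGreatlyWeaklyMahlo κ F) (α : Ordinal) (hα : α < κ) :
    {ξ | ξ < κ ∧ IsAlphaWeaklyMahlo ξ α} ∈ F.sets := by
  obtain ⟨-, hcomplete, -, hReg, hMl⟩ := hF
  induction α using WellFoundedLT.induction with
  | ind α ih =>
    rcases eq_or_ne α 0 with rfl | h0
    · refine F.superset_mem _ (hMl _ (hMl _ hReg)) _ (fun ξ hξ => ⟨hξ.1.1.1, ?_⟩)
        fun ξ hξ => hξ.1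
      rw [IsAlphaWeaklyMahlo]
      exact Or.inl ⟨rfl, isWeaklyMahlo_of_mem_Ml_Ml_regSet hξ⟩
    · refine F.superset_mem _ (hcomplete α hα
        (fun β => Ml {ξ | ξ < κ ∧ IsAlphaWeaklyMahlo ξ β})
        fun β hβ => hMl _ (ih β hβ (hβ.trans hα))) _ (fun ξ hξ => ⟨hξ.1, ?_⟩) fun ξ hξ => hξ.1
      rw [IsAlphaWeaklyMahlo]
      refine Or.inr ⟨h0, fun β hβ => ?_⟩
      exact (Set.mem_iInter₂.1 hξ.2 β hβ).2.2.mono fun μ hμ => ⟨hμ.2, hμ.1.2⟩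
end

section
/- Every greatly weakly Mahlo cardinal κ is hyper-weakly Mahlo; that is, the diagonal intersection Δ_{α<κ}{μ < κ : μ is α-weakly Mahlo} is a stationary subset of κ. -/
theorem IsUncRegular.isSuccLimit {κ : Ordinal} (h : IsUncRegular κ) : Order.IsSuccLimit κ := by
  rw [← h.2]
  apply Cardinal.isSuccLimit_ord
  rw [← Cardinal.omega0_le_ord, h.2]
  exact h.1.le

/-- A uniform normal filter on a limit ordinal contains every club. -/
theorem IsClubIn.mem_of_normal {κ : Ordinal} (hκ : Order.IsSuccLimit κ) {F : OrdFilter κ}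
    (hU : F.Uniform) (hN : F.Normal) {C : Set Ordinal} (hC : IsClubIn C κ) : C ∈ F.sets := by
  obtain ⟨hsub, hunb, hcl⟩ := hC
  have hnext : ∀ α : Ordinal, ∃ c, α < κ → c ∈ C ∧ α < c := by
    intro α
    by_cases hα : α < κ
    · obtain ⟨c, hc, hle⟩ := hunb _ (hκ.succ_lt hα)
      exact ⟨c, fun _ => ⟨hc, Order.succ_le_iff.1 hle⟩⟩
    · exact ⟨0, fun h => absurd h hα⟩
  choose f hf using hnext
  have hD := hN (fun α => Set.Iio κ \ Set.Iio (Order.succ (f α)))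
    fun α hα => hU _ (hκ.succ_lt (hsub (hf α hα).1))
  have h0 := hU _ (hκ.succ_lt hκ.bot_lt)
  refine F.superset_mem _ (F.inter_mem _ hD _ h0) C ?_ hsub
  rintro β ⟨⟨hβκ, hβ⟩, -, hβ0⟩
  have hβpos : ⊥ < β := Order.succ_le_iff.1 (not_lt.1 hβ0)
  have hfβ : ∀ α < β, f α < β := fun α hα =>
    Order.succ_le_iff.1 (not_lt.1 (hβ α hα).2)
  have hlub : IsLUB (C ∩ Set.Iio β) β := by
    refine ⟨fun x hx => hx.2.le, fun b hb => ?_⟩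
    by_contra hlt
    rw [not_le] at hlt
    obtain ⟨hmem, hgt⟩ := hf b (hlt.trans hβκ)
    exact (hb ⟨hmem, hfβ b hlt⟩).not_gt hgt
  have hne : (C ∩ Set.Iio β).Nonempty :=
    ⟨f ⊥, (hf ⊥ (hβpos.trans hβκ)).1, hfβ ⊥ hβpos⟩
  have hsup := hlub.csSup_eq hne
  have := hcl _ Set.inter_subset_left hne (hsup.symm ▸ hβκ)
  rwa [hsup] at this

/-- Members of a uniform normal filter on a limit ordinal are stationary. -/
theorem OrdFilter.isStationaryIn_of_normal {κ : Ordinal} (hκ : Order.IsSuccLimit κ)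
    {F : OrdFilter κ} (hU : F.Uniform) (hN : F.Normal) {S : Set Ordinal} (hS : S ∈ F.sets) :
    IsStationaryIn S κ := by
  intro C hC
  rw [Set.nonempty_iff_ne_empty]
  intro h
  exact F.proper (h ▸ F.inter_mem _ hS _ (hC.mem_of_normal hκ hU hN))

theorem WitnessesGreatlyWeaklyMahlo.isWeaklyMahlo_mem {κ : Ordinal} {F : OrdFilter κ}
    (hκ : IsUncRegular κ) (hF : WitnessesGreatlyWeaklyMahlo κ F) :
    {μ | μ < κ ∧ IsWeaklyMahlo μ} ∈ F.sets := by
  obtain ⟨hU, -, -, hR, hM⟩ := hF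
  have hS : {μ | μ < κ ∧ IsUncRegular μ} ∈ F.sets := by
    refine F.superset_mem _ (F.inter_mem _ hR _ (hU _ (hκ.isSuccLimit.succ_lt hκ.1))) _ ?_
      fun μ hμ => hμ.1
    rintro μ ⟨⟨hlt, -, hcof⟩, -, hω⟩
    exact ⟨hlt, Order.succ_le_iff.1 (not_lt.1 hω), hcof⟩
  refine F.superset_mem _ (hM _ hS) _ ?_ fun μ hμ => hμ.1
  rintro μ ⟨⟨hlt, hreg⟩, -, hst⟩
  refine ⟨hlt, hreg, fun C hC => (hst C hC).mono ?_⟩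
  rintro x ⟨⟨⟨-, hx⟩, hxμ⟩, hxC⟩
  exact ⟨⟨hxμ, hx⟩, hxC⟩

theorem WitnessesGreatlyWeaklyMahlo.isAlphaWeaklyMahlo_mem {κ : Ordinal} {F : OrdFilter κ}
    (hκ : IsUncRegular κ) (hF : WitnessesGreatlyWeaklyMahlo κ F) {α : Ordinal} (hα : α < κ) :
    {μ | μ < κ ∧ IsAlphaWeaklyMahlo μ α} ∈ F.sets := by
  induction α using WellFoundedLT.induction with
  | ind α ih =>
  rcases eq_or_ne α 0 with h0 | h0
  · refine F.superset_mem _ (hF.isWeaklyMahlo_mem hκ) _ ?_ fun μ hμ => hμ.1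
    rintro μ ⟨hlt, hμ⟩
    refine ⟨hlt, ?_⟩
    rw [IsAlphaWeaklyMahlo]
    exact Or.inl ⟨h0, hμ⟩
  · have hI := hF.2.1 α hα (fun β => Ml {μ | μ < κ ∧ IsAlphaWeaklyMahlo μ β})
      fun β hβ => hF.2.2.2.2 _ (ih β hβ (hβ.trans hα))
    refine F.superset_mem _ hI _ ?_ fun μ hμ => hμ.1
    rintro μ ⟨hlt, hμ⟩
    simp only [Set.mem_iInter] at hμ
    refine ⟨hlt, ?_⟩
    rw [IsAlphaWeaklyMahlo]
    refine Or.inr ⟨h0, fun β hβ C hC => ((hμ β hβ).2.2 C hC).mono ?_⟩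
    rintro x ⟨⟨⟨-, hx⟩, hxμ⟩, hxC⟩
    exact ⟨⟨hxμ, hx⟩, hxC⟩

/-- Every greatly weakly Mahlo cardinal is hyper-weakly Mahlo: the diagonal intersection
`Δ_{α<κ} {μ < κ : μ is α-weakly Mahlo}` is stationary in `κ`. -/
theorem statement9 (κ : Ordinal) (hκ : IsGreatlyWeaklyMahlo κ) :
    IsStationaryIn (diagInter κ (fun α => {μ | μ < κ ∧ IsAlphaWeaklyMahlo μ α})) κ := by
  obtain ⟨⟨hreg, -⟩, F, hF⟩ := hκ
  exact F.isStationaryIn_of_normal hreg.isSuccLimit hF.1 hF.2.2.1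
    (hF.2.2.1 _ fun _ hα => hF.isAlphaWeaklyMahlo_mem hreg hα)
end

section
/- Let μ be a cardinal with μ > ℵ₁, and let S ⊆ [μ]^{ℵ₀} be a stationary subset of [μ]^{ℵ₀} such that S ∩ [X]^{ℵ₀} is non-stationary in [X]^{ℵ₀} for every X ⊆ μ with |X| < μ and ω₁ ⊆ X. Then for every cardinal λ ≥ μ, the set S' := {x ∈ [λ]^{ℵ₀} : x ∩ μ ∈ S} is a stationary subset of [λ]^{ℵ₀} such that for every X ⊆ λ with |X| < μ and ω₁ ⊆ X, the set S' ∩ [X]^{ℵ₀} is non-stationary in [X]^{ℵ₀}. -/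
def ctblInf {α : Type*} (X : Set α) : Set (Set α) :=
  {x | x ⊆ X ∧ x.Countable ∧ x.Infinite}

/-- `C ⊆ [X]^{ℵ₀}` is club: cofinal (every countable subset of `X` is contained in a
member of `C`) and closed under unions of `⊆`-increasing `ω`-sequences of members. -/
def IsClubOn {α : Type*} (X : Set α) (C : Set (Set α)) : Prop :=
  C ⊆ ctblInf X ∧
    (∀ x : Set α, x ⊆ X → x.Countable → ∃ y ∈ C, x ⊆ y) ∧
    ∀ f : ℕ → Set α, (∀ n, f n ∈ C) → (∀ m n : ℕ, m ≤ n → f m ⊆ f n) →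
      (⋃ n, f n) ∈ C

/-- `S ⊆ [X]^{ℵ₀}` is stationary: it meets every club subset of `[X]^{ℵ₀}`. -/
def IsStatOn {α : Type*} (X : Set α) (S : Set (Set α)) : Prop :=
  ∀ C : Set (Set α), IsClubOn X C → (S ∩ C).Nonempty

section Lifting

variable {α : Type*} {A B : Set α} {C S : Set (Set α)}

theorem Finset.exists_coe_subset_of_subset_iUnion {s : ℕ → Set α} (hs : Monotone s)
    (e : Finset α) (he : (e : Set α) ⊆ ⋃ n, s n) : ∃ n, (e : Set α) ⊆ s n :=
  hs.directed_le.exists_mem_subset_of_finset_subset_biUnion he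

/-- The pointwise union of `F` over the finite subsets of `y`. -/
def finsetUnion (F : Finset α → Set α) (y : Set α) : Set α :=
  ⋃ e : Finset α, ⋃ _ : (e : Set α) ⊆ y, F e

theorem mem_finsetUnion {F : Finset α → Set α} {y : Set α} {a : α} :
    a ∈ finsetUnion F y ↔ ∃ e : Finset α, (e : Set α) ⊆ y ∧ a ∈ F e := by
  simp [finsetUnion]

theorem finsetUnion_mono (F : Finset α → Set α) : Monotone (finsetUnion F) := by
  intro y z hyz a ha
  obtain ⟨e, he, ha⟩ := mem_finsetUnion.1 ha
  exact mem_finsetUnion.2 ⟨e, he.trans hyz, ha⟩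

theorem finsetUnion_iUnion (F : Finset α → Set α) {s : ℕ → Set α} (hs : Monotone s) :
    finsetUnion F (⋃ n, s n) = ⋃ n, finsetUnion F (s n) := by
  refine subset_antisymm (fun a ha => ?_)
    (Set.iUnion_subset fun n => finsetUnion_mono F (Set.subset_iUnion s n))
  obtain ⟨e, he, ha⟩ := mem_finsetUnion.1 ha
  obtain ⟨n, hn⟩ := e.exists_coe_subset_of_subset_iUnion hs he
  exact Set.mem_iUnion.2 ⟨n, mem_finsetUnion.2 ⟨e, hn, ha⟩⟩

theorem IsClubOn.exists_monotone_finset (hC : IsClubOn B C) :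
    ∃ F : Finset α → Set α, (∀ e, F e ∈ C) ∧ (∀ e : Finset α, ↑e ∩ B ⊆ F e) ∧ Monotone F := by
  classical
  obtain ⟨hsub, hcof, -⟩ := hC
  have h (x : Set α) : ∃ y ∈ C, x.Countable → x ∩ B ⊆ y := by
    by_cases hx : x.Countable
    · obtain ⟨y, hy, hxy⟩ := hcof (x ∩ B) Set.inter_subset_right (hx.mono Set.inter_subset_left)
      exact ⟨y, hy, fun _ => hxy⟩
    · obtain ⟨y, hy, -⟩ := hcof ∅ (Set.empty_subset _) Set.countable_empty
      exact ⟨y, hy, fun h => absurd h hx⟩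
  choose g hgC hg using h
  let H : ∀ e : Finset α, (∀ t, t ⊂ e → Set α) → Set α :=
    fun e f => g (↑e ∪ ⋃ t : e.ssubsets, f t (Finset.mem_ssubsets.1 t.2))
  let F : Finset α → Set α := Finset.strongInduction H
  have hF (e : Finset α) : F e = g (↑e ∪ ⋃ t : e.ssubsets, F t) := Finset.strongInduction_eq H e
  have hFC (e : Finset α) : F e ∈ C := hF e ▸ hgC _
  have hFsup (e : Finset α) : (↑e ∪ ⋃ t : e.ssubsets, F t) ∩ B ⊆ F e := by
    rw [hF e]
    exact hg _ (e.countable_toSet.union (Set.countable_iUnion fun t => (hsub (hFC t)).2.1))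
  refine ⟨F, hFC, fun e => (Set.inter_subset_inter_left _ Set.subset_union_left).trans (hFsup e),
    fun t e hte => ?_⟩
  rcases hte.eq_or_lt with rfl | hlt
  · exact le_rfl
  · intro a ha
    exact hFsup e ⟨Or.inr (Set.mem_iUnion.2 ⟨⟨t, Finset.mem_ssubsets.2 hlt⟩, ha⟩),
      (hsub (hFC t)).1 ha⟩

theorem IsClubOn.finsetUnion_mem (hC : IsClubOn B C) {F : Finset α → Set α}
    (hFC : ∀ e, F e ∈ C) (hF : Monotone F) {y : Set α} (hy : y.Countable) (hne : y.Nonempty) :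
    finsetUnion F y ∈ C := by
  classical
  obtain ⟨u, rfl⟩ := hy.exists_eq_range hne
  have hmono : Monotone fun n => (Finset.range n).image u := fun m n hmn =>
    Finset.image_subset_image (Finset.range_mono hmn)
  have heq : finsetUnion F (Set.range u) = ⋃ n, F ((Finset.range n).image u) := by
    ext a
    rw [mem_finsetUnion, Set.mem_iUnion]
    constructor
    · rintro ⟨e, he, ha⟩
      have hcov : (e : Set α) ⊆ ⋃ n, (((Finset.range n).image u : Finset α) : Set α) := by
        intro b hb
        obtain ⟨n, rfl⟩ := he hb
        exact Set.mem_iUnion.2 ⟨n + 1, by simpa using ⟨n, le_rfl, rfl⟩⟩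
      obtain ⟨n, hn⟩ := e.exists_coe_subset_of_subset_iUnion
        (fun m n hmn => Finset.coe_subset.2 (hmono hmn)) hcov
      exact ⟨n, hF (Finset.coe_subset.1 hn) ha⟩
    · rintro ⟨n, ha⟩
      exact ⟨_, by simp, ha⟩
  rw [heq]
  exact hC.2.2 _ (fun n => hFC _) fun m n hmn => hF (hmono hmn)

/-- Stationarity lifts from `[A]^{ℵ₀}` to `[B]^{ℵ₀}` along `x ↦ x ∩ A`. -/
theorem IsStatOn.lift (hAB : A ⊆ B) (hA : A.Infinite) (hS : IsStatOn A S) :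
    IsStatOn B {x | x ∈ ctblInf B ∧ x ∩ A ∈ S} := by
  intro C hC
  obtain ⟨F, hFC, hFB, hFmono⟩ := hC.exists_monotone_finset
  have hmem {y : Set α} (hy : y ∈ ctblInf A) : finsetUnion F y ∈ C :=
    hC.finsetUnion_mem hFC hFmono hy.2.1 hy.2.2.nonempty
  have hle {y : Set α} (hy : y ∈ ctblInf A) : y ⊆ finsetUnion F y ∩ A := fun a ha =>
    ⟨mem_finsetUnion.2 ⟨{a}, by simpa using ha, hFB _ ⟨by simp, hAB (hy.1 ha)⟩⟩, hy.1 ha⟩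
  have hstep {y : Set α} (hy : y ∈ ctblInf A) : finsetUnion F y ∩ A ∈ ctblInf A :=
    ⟨Set.inter_subset_right, (hC.1 (hmem hy)).2.1.mono Set.inter_subset_left,
      hy.2.2.mono (hle hy)⟩
  have hunion {f : ℕ → Set α} (hf : ∀ n, f n ∈ ctblInf A) : (⋃ n, f n) ∈ ctblInf A :=
    ⟨Set.iUnion_subset fun n => (hf n).1, Set.countable_iUnion fun n => (hf n).2.1,
      (hf 0).2.2.mono (Set.subset_iUnion f 0)⟩
  have hD : IsClubOn A {y | y ∈ ctblInf A ∧ finsetUnion F y ∩ A = y} := by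
    refine ⟨fun y hy => hy.1, fun x hx hxc => ?_, fun f hf hmono => ?_⟩
    · let g : ℕ → Set α := fun n => (fun y => finsetUnion F y ∩ A)^[n]
        (x ∪ Set.range fun n => (hA.natEmbedding A n : α))
      have hg0 : g 0 ∈ ctblInf A :=
        ⟨Set.union_subset hx (Set.range_subset_iff.2 fun n => (hA.natEmbedding A n).2),
          hxc.union (Set.countable_range _),
          (Set.infinite_range_of_injective
            (Subtype.val_injective.comp (hA.natEmbedding A).injective)).mono Set.subset_union_right⟩
      have hgs (n : ℕ) : g (n + 1) = finsetUnion F (g n) ∩ A := Function.iterate_succ_apply' _ _ _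
      have hg (n : ℕ) : g n ∈ ctblInf A := by
        induction n with
        | zero => exact hg0
        | succ n ih => exact hgs n ▸ hstep ih
      have hgm : Monotone g := monotone_nat_of_le_succ fun n => hgs n ▸ hle (hg n)
      refine ⟨⋃ n, g n, ⟨hunion hg, ?_⟩,
        Set.subset_union_left.trans (Set.subset_iUnion g 0)⟩
      refine subset_antisymm ?_ (hle (hunion hg))
      rw [finsetUnion_iUnion F hgm, Set.iUnion_inter]
      exact Set.iUnion_subset fun n => hgs n ▸ Set.subset_iUnion g (n + 1)
    · refine ⟨hunion fun n => (hf n).1, ?_⟩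
      rw [finsetUnion_iUnion F fun m n hmn => hmono m n hmn, Set.iUnion_inter]
      exact Set.iUnion_congr fun n => (hf n).2
  obtain ⟨y, hyS, hyA, hy⟩ := hS _ hD
  exact ⟨finsetUnion F y, ⟨hC.1 (hmem hyA), hy.symm ▸ hyS⟩, hmem hyA⟩

/-- The preimage of a club of `[X ∩ A]^{ℵ₀}` under `x ↦ x ∩ A` is a club of `[X]^{ℵ₀}`. -/
theorem IsClubOn.comap_inter {X : Set α} (hC : IsClubOn (X ∩ A) C) :
    IsClubOn X {x | x ∈ ctblInf X ∧ x ∩ A ∈ C} := by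
  refine ⟨fun x hx => hx.1, fun x hx hxc => ?_, fun f hf hmono => ⟨⟨?_, ?_, ?_⟩, ?_⟩⟩
  · obtain ⟨y, hy, hxy⟩ := hC.2.1 (x ∩ A) (Set.inter_subset_inter_left _ hx)
      (hxc.mono Set.inter_subset_left)
    obtain ⟨hyX, hyc, hyi⟩ := hC.1 hy
    refine ⟨x ∪ y, ⟨⟨Set.union_subset hx (hyX.trans Set.inter_subset_left), hxc.union hyc,
      hyi.mono Set.subset_union_right⟩, ?_⟩, Set.subset_union_left⟩
    rwa [Set.union_inter_distrib_right, Set.inter_eq_left.2 (hyX.trans Set.inter_subset_right),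
      Set.union_eq_right.2 hxy]
  · exact Set.iUnion_subset fun n => (hf n).1.1
  · exact Set.countable_iUnion fun n => (hf n).1.2.1
  · exact (hf 0).1.2.2.mono (Set.subset_iUnion f 0)
  · rw [Set.iUnion_inter]
    exact hC.2.2 _ (fun n => (hf n).2) fun m n hmn => Set.inter_subset_inter_left _ (hmono m n hmn)

end Lifting

/-- If `μ > ℵ₁` and `S ⊆ [μ]^{ℵ₀}` is stationary but `S ∩ [X]^{ℵ₀}` is non-stationary
for all `X ⊆ μ` with `|X| < μ` and `ω₁ ⊆ X`, then for every `λ ≥ μ` the set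
`S' = {x ∈ [λ]^{ℵ₀} : x ∩ μ ∈ S}` is stationary in `[λ]^{ℵ₀}` and `S' ∩ [X]^{ℵ₀}` is
non-stationary for all `X ⊆ λ` with `|X| < μ` and `ω₁ ⊆ X`. -/
theorem statement14 (μ : Cardinal.{0}) (hμ : Cardinal.aleph 1 < μ)
    (S : Set (Set Ordinal)) (hSsub : S ⊆ ctblInf (Set.Iio μ.ord))
    (hstat : IsStatOn (Set.Iio μ.ord) S)
    (hnonrefl : ∀ X : Set Ordinal, X ⊆ Set.Iio μ.ord →
      Cardinal.mk X < Cardinal.lift.{1,0} μ →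
      Set.Iio (Cardinal.aleph 1).ord ⊆ X → ¬ IsStatOn X (S ∩ ctblInf X))
    (lam : Cardinal) (hlam : μ ≤ lam) :
    IsStatOn (Set.Iio lam.ord)
        {x | x ∈ ctblInf (Set.Iio lam.ord) ∧ x ∩ Set.Iio μ.ord ∈ S} ∧
      ∀ X : Set Ordinal, X ⊆ Set.Iio lam.ord →
        Cardinal.mk X < Cardinal.lift.{1,0} μ →
        Set.Iio (Cardinal.aleph 1).ord ⊆ X →
        ¬ IsStatOn X
          ({x | x ∈ ctblInf (Set.Iio lam.ord) ∧ x ∩ Set.Iio μ.ord ∈ S} ∩ ctblInf X) := by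
  have hsub : Set.Iio μ.ord ⊆ Set.Iio lam.ord := Set.Iio_subset_Iio (Cardinal.ord_le_ord.2 hlam)
  have hinf : (Set.Iio μ.ord).Infinite := by
    refine (Set.infinite_range_of_injective (Nat.cast_injective (R := Ordinal.{0}))).mono ?_
    rintro _ ⟨n, rfl⟩
    have h0 : Cardinal.aleph0 ≤ μ := (Cardinal.aleph0_le_aleph 1).trans hμ.le
    exact (Ordinal.natCast_lt_omega0 n).trans_le
      (Cardinal.ord_aleph0 ▸ Cardinal.ord_le_ord.2 h0)
  refine ⟨hstat.lift hsub hinf, fun X _ hXcard hX hXstat => ?_⟩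
  refine hnonrefl (X ∩ Set.Iio μ.ord) Set.inter_subset_right
    ((Cardinal.mk_le_mk_of_subset Set.inter_subset_left).trans_lt hXcard)
    (Set.subset_inter hX (Set.Iio_subset_Iio (Cardinal.ord_le_ord.2 hμ.le))) fun D hD => ?_
  obtain ⟨x, ⟨⟨-, hxS⟩, -⟩, -, hxD⟩ := hXstat _ hD.comap_inter
  exact ⟨x ∩ Set.Iio μ.ord, ⟨hxS, hD.1 hxD⟩, hxD⟩
end
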